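/- arXiv:2507.17878 — 2 statements merged into one kernel-verified Lean document; each statement's English description precedes it below -/
import Mathlib

section
/- There exists a constant C₀ > 0 such that the following holds with ε = 0.0028 (this is the existential, non-algorithmic content of the paper's main theorem). For every monotone 1-in-3-SAT instance with finite variable set X, |X| = n, and clause set C ⊆ X³, there exists an equivalence relation ∼ on X such that: (a) whenever x ∼ y, every solution s of the instance satisfies s(x) = s(y); and (b) the quotient clause set { ([x]_∼, [y]_∼, [z]_∼) : (x, y, z) ∈ C } has at most C₀ · n^{2 − ε} elements. -/
open scoped Classical

/-- The one-coordinate inequality behind the energy exponent `8 / 3` on the cube, after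
substituting cubes for the two weights. -/
lemma octic_form_pow_le {u v : ℝ} (hu : 0 ≤ u) (hv : 0 ≤ v) :
    (u ^ 8 + v ^ 8 + 4 * (u ^ 4 * v ^ 4)) ^ 3 ≤ (u ^ 3 + v ^ 3) ^ 8 := by
  have amgm : ∀ x y : ℝ, 0 ≤ x → 0 ≤ y → 0 ≤ 2 * x ^ 3 + y ^ 3 - 3 * x ^ 2 * y := by
    intro x y hx hy
    nlinarith [mul_nonneg (by positivity : 0 ≤ 2 * x + y) (sq_nonneg (x - y))]
  have h₁ := mul_nonneg (by positivity : 0 ≤ u ^ 18 * v ^ 3) (amgm u v hu hv)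
  have h₂ := mul_nonneg (by positivity : 0 ≤ v ^ 18 * u ^ 3) (amgm v u hv hu)
  have h₃ := mul_nonneg (by positivity : 0 ≤ u ^ 15 * v ^ 6) (amgm v u hv hu)
  have h₄ := mul_nonneg (by positivity : 0 ≤ v ^ 15 * u ^ 6) (amgm u v hu hv)
  have h₅ : 0 ≤ u ^ 9 * v ^ 9 * (u ^ 3 - v ^ 3) ^ 2 := by positivity
  have h₆ : 0 ≤ u ^ 18 * v ^ 6 := by positivity
  have h₇ : 0 ≤ v ^ 18 * u ^ 6 := by positivity
  have h₈ : 0 ≤ u ^ 12 * v ^ 12 := by positivity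
  linear_combination 4 * h₁ + 4 * h₂ + 17 * h₃ + 17 * h₄ + 22 * h₅ + 7 * h₆ + 7 * h₇ + 26 * h₈

lemma rpow_two_thirds_form_le {a b : ℝ} (ha : 0 ≤ a) (hb : 0 ≤ b) :
    (a ^ (2 / 3 : ℝ)) ^ 4 + (b ^ (2 / 3 : ℝ)) ^ 4
      + 4 * ((a ^ (2 / 3 : ℝ)) ^ 2 * (b ^ (2 / 3 : ℝ)) ^ 2) ≤ ((a + b) ^ (2 / 3 : ℝ)) ^ 4 := by
  have cube : ∀ x : ℝ, 0 ≤ x → (x ^ (1 / 3 : ℝ)) ^ 3 = x := fun x hx => by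
    rw [← Real.rpow_natCast, ← Real.rpow_mul hx]; norm_num
  have square : ∀ x : ℝ, 0 ≤ x → x ^ (2 / 3 : ℝ) = (x ^ (1 / 3 : ℝ)) ^ 2 := fun x hx => by
    rw [← Real.rpow_natCast, ← Real.rpow_mul hx]; norm_num
  have hab := add_nonneg ha hb
  have h := octic_form_pow_le (Real.rpow_nonneg ha (1 / 3)) (Real.rpow_nonneg hb (1 / 3))
  rw [cube a ha, cube b hb] at h
  rw [square a ha, square b hb, square _ hab]
  refine le_of_pow_le_pow_left₀ three_ne_zero (by positivity) ?_
  calc _ = ((a ^ (1 / 3 : ℝ)) ^ 8 + (b ^ (1 / 3 : ℝ)) ^ 8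
          + 4 * ((a ^ (1 / 3 : ℝ)) ^ 4 * (b ^ (1 / 3 : ℝ)) ^ 4)) ^ 3 := by ring
    _ ≤ (a + b) ^ 8 := h
    _ = (((a + b) ^ (1 / 3 : ℝ)) ^ 3) ^ 8 := by rw [cube _ hab]
    _ = _ := by ring

lemma trilinear_le_of_quartic_form_le {α₀ α₁ β₀ β₁ γ₀ γ₁ A B G : ℝ}
    (hA₀ : 0 ≤ A) (hB₀ : 0 ≤ B) (hG₀ : 0 ≤ G)
    (hA : α₀ ^ 4 + α₁ ^ 4 + 4 * (α₀ ^ 2 * α₁ ^ 2) ≤ A ^ 4)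
    (hB : β₀ ^ 4 + β₁ ^ 4 + 4 * (β₀ ^ 2 * β₁ ^ 2) ≤ B ^ 4)
    (hG : γ₀ ^ 2 + γ₁ ^ 2 = G ^ 2) :
    α₁ * β₀ * γ₀ + α₀ * β₁ * γ₀ + α₀ * β₀ * γ₁ ≤ A * B * G := by
  have hsq : (α₁ * β₀ + α₀ * β₁) ^ 2 + (α₀ * β₀) ^ 2 ≤ (A * B) ^ 2 := by
    refine le_of_pow_le_pow_left₀ two_ne_zero (by positivity) ?_
    calc _ ≤ ((α₀ ^ 2 + α₁ ^ 2) * (β₀ ^ 2 + β₁ ^ 2) + 2 * (α₀ * α₁) * (β₀ * β₁)) ^ 2 := by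
          refine pow_le_pow_left₀ (by positivity) ?_ 2
          nlinarith [sq_nonneg (α₁ * β₁)]
      _ ≤ (α₀ ^ 4 + α₁ ^ 4 + 4 * (α₀ ^ 2 * α₁ ^ 2))
            * (β₀ ^ 4 + β₁ ^ 4 + 4 * (β₀ ^ 2 * β₁ ^ 2)) := by
          linear_combination
            2 * sq_nonneg ((α₀ ^ 2 + α₁ ^ 2) * (β₀ * β₁) - (β₀ ^ 2 + β₁ ^ 2) * (α₀ * α₁))
      _ ≤ A ^ 4 * B ^ 4 := by gcongr
      _ = _ := by ring
  refine le_of_pow_le_pow_left₀ two_ne_zero (by positivity) ?_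
  calc _ ≤ ((α₁ * β₀ + α₀ * β₁) ^ 2 + (α₀ * β₀) ^ 2) * (γ₀ ^ 2 + γ₁ ^ 2) := by
        linear_combination sq_nonneg ((α₁ * β₀ + α₀ * β₁) * γ₁ - α₀ * β₀ * γ₀)
    _ ≤ (A * B) ^ 2 * G ^ 2 := by rw [hG]; gcongr
    _ = _ := by ring

lemma rpow_trilinear_le {a₀ a₁ b₀ b₁ c₀ c₁ : ℝ} (ha₀ : 0 ≤ a₀) (ha₁ : 0 ≤ a₁)
    (hb₀ : 0 ≤ b₀) (hb₁ : 0 ≤ b₁) (hc₀ : 0 ≤ c₀) (hc₁ : 0 ≤ c₁) :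
    a₁ ^ (2 / 3 : ℝ) * b₀ ^ (2 / 3 : ℝ) * c₀ ^ (1 / 2 : ℝ)
      + a₀ ^ (2 / 3 : ℝ) * b₁ ^ (2 / 3 : ℝ) * c₀ ^ (1 / 2 : ℝ)
      + a₀ ^ (2 / 3 : ℝ) * b₀ ^ (2 / 3 : ℝ) * c₁ ^ (1 / 2 : ℝ)
      ≤ (a₀ + a₁) ^ (2 / 3 : ℝ) * (b₀ + b₁) ^ (2 / 3 : ℝ) * (c₀ + c₁) ^ (1 / 2 : ℝ) := by
  have sqrt_sq : ∀ x : ℝ, 0 ≤ x → (x ^ (1 / 2 : ℝ)) ^ 2 = x := fun x hx => by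
    rw [← Real.rpow_natCast, ← Real.rpow_mul hx]; norm_num
  refine trilinear_le_of_quartic_form_le (by positivity) (by positivity)
    (by positivity) (rpow_two_thirds_form_le ha₀ ha₁) (rpow_two_thirds_form_le hb₀ hb₁) ?_
  rw [sqrt_sq _ hc₀, sqrt_sq _ hc₁, sqrt_sq _ (add_nonneg hc₀ hc₁)]

/-- If points of `I`, `J` and `K` are separated by the Boolean functions `f s`, `s ∈ S`, then few
triples in `I × J × K` satisfy the 1-in-3 condition for all of these functions. -/
lemma card_oneInThree_triples_le {ι V : Type*} (f : ι → V → Bool) (S : Finset ι) :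
    ∀ I J K : Finset V,
      (∀ x ∈ I, ∀ y ∈ I, (∀ s ∈ S, f s x = f s y) → x = y) →
      (∀ x ∈ J, ∀ y ∈ J, (∀ s ∈ S, f s x = f s y) → x = y) →
      (∀ x ∈ K, ∀ y ∈ K, (∀ s ∈ S, f s x = f s y) → x = y) →
      (((I ×ˢ J ×ˢ K).filter fun c =>
        ∀ s ∈ S, (f s c.1).toNat + (f s c.2.1).toNat + (f s c.2.2).toNat = 1).card : ℝ)
        ≤ (I.card : ℝ) ^ (2 / 3 : ℝ) * (J.card : ℝ) ^ (2 / 3 : ℝ)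
          * (K.card : ℝ) ^ (1 / 2 : ℝ) := by
  induction S using Finset.induction_on with
  | empty =>
    intro I J K hI hJ hK
    have subsingleton_card : ∀ L : Finset V,
        (∀ x ∈ L, ∀ y ∈ L, (∀ s ∈ (∅ : Finset ι), f s x = f s y) → x = y) →
          L.card = 0 ∨ L.card = 1 := fun L hL => by
      have : L.card ≤ 1 := Finset.card_le_one.2 fun x hx y hy => hL x hx y hy (by simp)
      omega
    have hle : (((I ×ˢ J ×ˢ K).filter fun c => ∀ s ∈ (∅ : Finset ι),
        (f s c.1).toNat + (f s c.2.1).toNat + (f s c.2.2).toNat = 1).card : ℝ)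
        ≤ (I.card : ℝ) * ((J.card : ℝ) * (K.card : ℝ)) := by
      exact_mod_cast (Finset.card_filter_le _ _).trans_eq (by simp [Finset.card_product])
    refine hle.trans ?_
    rcases subsingleton_card I hI with h | h <;> rcases subsingleton_card J hJ with h' | h' <;>
      rcases subsingleton_card K hK with h'' | h'' <;> simp [h, h', h'']
  | insert t S _ ih =>
    intro I J K hI hJ hK
    have separated : ∀ L : Finset V,
        (∀ x ∈ L, ∀ y ∈ L, (∀ s ∈ insert t S, f s x = f s y) → x = y) →
        ∀ b : Bool, ∀ x ∈ L.filter (fun x => f t x = b), ∀ y ∈ L.filter (fun x => f t x = b),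
          (∀ s ∈ S, f s x = f s y) → x = y := by
      intro L hL b x hx y hy h
      rw [Finset.mem_filter] at hx hy
      exact hL x hx.1 y hy.1 ((Finset.forall_mem_insert _ _ _).2 ⟨hx.2.trans hy.2.symm, h⟩)
    have card_split : ∀ L : Finset V, (L.card : ℝ)
        = (L.filter fun x => f t x = false).card + (L.filter fun x => f t x = true).card := by
      intro L
      have := Finset.card_filter_add_card_filter_not (s := L) (fun x => f t x = false)
      simp only [Bool.not_eq_false] at this
      exact_mod_cast this.symm
    have h₁ := ih _ _ _ (separated I hI true) (separated J hJ false) (separated K hK false)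
    have h₂ := ih _ _ _ (separated I hI false) (separated J hJ true) (separated K hK false)
    have h₃ := ih _ _ _ (separated I hI false) (separated J hJ false) (separated K hK true)
    rw [card_split I, card_split J, card_split K]
    refine le_trans ?_ (rpow_trilinear_le (Nat.cast_nonneg _) (Nat.cast_nonneg _)
      (Nat.cast_nonneg _) (Nat.cast_nonneg _) (Nat.cast_nonneg _) (Nat.cast_nonneg _))
    refine le_trans ?_ (add_le_add (add_le_add h₁ h₂) h₃)
    norm_cast
    refine le_trans (Finset.card_le_card ?_)
      ((Finset.card_union_le _ _).trans (Nat.add_le_add_right (Finset.card_union_le _ _) _))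
    rintro ⟨x, y, z⟩ h
    simp only [Finset.mem_filter, Finset.mem_product, Finset.mem_union,
      Finset.forall_mem_insert] at h ⊢
    obtain ⟨⟨hx, hy, hz⟩, ht, hS⟩ := h
    cases hfx : f t x <;> cases hfy : f t y <;> cases hfz : f t z <;>
      rw [hfx, hfy, hfz] at ht <;>
      first
        | exact absurd ht (by decide)
        | simpa [hx, hy, hz, hfx, hfy, hfz] using hS

/-- (Main theorem, existential content.) There is `C₀ > 0` such that, with
`ε = 0.0028`, for every monotone 1-in-3-SAT instance on `n` variables there is an equivalence
relation `∼` on the variables such that (a) related variables take equal values in every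
solution, and (b) the quotient clause set has at most `C₀ * n ^ (2 - ε)` elements. -/
theorem statement17 :
    ∃ C₀ : ℝ, 0 < C₀ ∧
      ∀ (X : Type) [Fintype X] (C : Finset (X × X × X)),
        ∃ r : Setoid X,
          (∀ x y : X, r.r x y →
            ∀ s : X → Bool,
              (∀ c ∈ C, (s c.1).toNat + (s c.2.1).toNat + (s c.2.2).toNat = 1) →
              s x = s y) ∧
          ((C.image (fun c =>
              (Quotient.mk r c.1, Quotient.mk r c.2.1, Quotient.mk r c.2.2))).card : ℝ)
            ≤ C₀ * (Fintype.card X : ℝ) ^ ((2 : ℝ) - 0.0028) := by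
  refine ⟨1, one_pos, fun X _ C => ?_⟩
  let S : Finset (X → Bool) := Finset.univ.filter fun s =>
    ∀ c ∈ C, (s c.1).toNat + (s c.2.1).toNat + (s c.2.2).toNat = 1
  let r : Setoid X :=
    { r := fun x y => ∀ s ∈ S, s x = s y
      iseqv := ⟨fun _ _ _ => rfl, fun h s hs => (h s hs).symm,
        fun h h' s hs => (h s hs).trans (h' s hs)⟩ }
  refine ⟨r, fun x y h s hs => h s (Finset.mem_filter.2 ⟨Finset.mem_univ _, hs⟩), ?_⟩
  have out_mk : ∀ s ∈ S, ∀ x : X, s (Quotient.mk r x).out = s x := fun s hs x =>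
    Quotient.mk_out (s := r) x s hs
  have separated : ∀ x ∈ (Finset.univ : Finset (Quotient r)), ∀ y ∈ Finset.univ,
      (∀ s ∈ S, s x.out = s y.out) → x = y := fun x _ y _ h => Quotient.out_equiv_out.1 h
  have hT := card_oneInThree_triples_le (fun (s : X → Bool) (q : Quotient r) => s q.out) S
    Finset.univ Finset.univ Finset.univ separated separated separated
  have hquot : Fintype.card (Quotient r) ≤ Fintype.card X :=
    Fintype.card_le_of_surjective _ Quotient.mk_surjective
  rcases isEmpty_or_nonempty X with hX | hX
  · have : C = ∅ := Finset.eq_empty_of_isEmpty C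
    subst this
    simp only [Finset.image_empty, Finset.card_empty, Nat.cast_zero]
    positivity
  have hn : (1 : ℝ) ≤ Fintype.card X := by exact_mod_cast Fintype.card_pos
  rw [Finset.card_univ] at hT
  have hbound : (Fintype.card (Quotient r) : ℝ) ^ (2 / 3 : ℝ)
      * (Fintype.card (Quotient r) : ℝ) ^ (2 / 3 : ℝ)
      * (Fintype.card (Quotient r) : ℝ) ^ (1 / 2 : ℝ)
      ≤ (Fintype.card X : ℝ) ^ ((2 : ℝ) - 0.0028) :=
    calc _ ≤ (Fintype.card X : ℝ) ^ (2 / 3 : ℝ) * (Fintype.card X : ℝ) ^ (2 / 3 : ℝ)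
          * (Fintype.card X : ℝ) ^ (1 / 2 : ℝ) := by gcongr
      _ = (Fintype.card X : ℝ) ^ (11 / 6 : ℝ) := by
          rw [← Real.rpow_add (by positivity), ← Real.rpow_add (by positivity)]; norm_num
      _ ≤ (Fintype.card X : ℝ) ^ ((2 : ℝ) - 0.0028) :=
          Real.rpow_le_rpow_of_exponent_le hn (by norm_num)
  rw [one_mul]
  refine (Nat.cast_le.2 (Finset.card_le_card ?_)).trans (hT.trans hbound)
  intro q hq
  obtain ⟨c, hc, rfl⟩ := Finset.mem_image.1 hq
  refine (@Finset.mem_filter _ _ (_) _ _).2 ⟨by simp, fun s hs => ?_⟩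
  simp only [out_mk s hs]
  exact (Finset.mem_filter.1 hs).2 c hc
end

section
/- Let f : ℕ → ℕ and suppose that for every monotone 1-in-3-SAT instance with finite variable set Y, |Y| = m, and clause set D ⊆ Y³, there exists an equivalence relation ∼ on Y such that (a) whenever u ∼ w, every solution of the instance assigns u and w the same value, and (b) the quotient clause set {([u]_∼, [v]_∼, [w]_∼) : (u, v, w) ∈ D} has at most f(m) elements. Then for every non-monotone 1-in-3-SAT instance with finite variable set X, |X| = n, and clause set C ⊆ (X × {+,−})³ of triples of literals, there exists an equivalence relation ≈ on X such that (a) whenever x ≈ y, every solution of the instance assigns x and y the same value, and (b) the quotient clause set {(([x₁]_≈, b₁), ([x₂]_≈, b₂), ([x₃]_≈, b₃)) : ((x₁,b₁),(x₂,b₂),(x₃,b₃)) ∈ C} has at most 8 · f(2n) elements. -/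
open scoped Classical

/-- If the values of `q` determine those of `g`, then `g` takes at most as many values as `q`. -/
theorem card_image_le_card_image_of_factors {α β γ : Type*} [DecidableEq β] [DecidableEq γ]
    (s : Finset α) (g : α → β) (q : α → γ)
    (h : ∀ a ∈ s, ∀ b ∈ s, q a = q b → g a = g b) :
    (s.image g).card ≤ (s.image q).card := by
  rcases isEmpty_or_nonempty α with hα | hα
  · simp [Finset.eq_empty_of_isEmpty s]
  have hex : ∀ y ∈ s.image g, ∃ a ∈ s, g a = y := fun y hy => Finset.mem_image.mp hy
  choose! p hps hpg using hex
  refine Finset.card_le_card_of_injOn (fun y => q (p y))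
    (fun y hy => Finset.mem_image_of_mem q (hps y hy)) ?_
  intro y hy z hz hyz
  rw [← hpg y hy, ← hpg z hz]
  exact h _ (hps y hy) _ (hps z hz) hyz

/-- A strong sparsification algorithm for monotone 1-in-3-SAT with performance
`f` yields one for non-monotone 1-in-3-SAT with performance `8 * f (2n)`. Literals are pairs
`(x, b)` with sign `b : Bool` (`true` = positive); literal `(x, b)` is satisfied by `s` iff
`s x = b`. -/
theorem statement18 (f : ℕ → ℕ)
    (hmono : ∀ (Y : Type) [Fintype Y] (D : Finset (Y × Y × Y)),
      ∃ r : Setoid Y,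
        (∀ u w : Y, r.r u w →
          ∀ t : Y → Bool,
            (∀ c ∈ D, (t c.1).toNat + (t c.2.1).toNat + (t c.2.2).toNat = 1) →
            t u = t w) ∧
        (D.image (fun c =>
            (Quotient.mk r c.1, Quotient.mk r c.2.1, Quotient.mk r c.2.2))).card
          ≤ f (Fintype.card Y)) :
    ∀ (X : Type) [Fintype X] (C : Finset ((X × Bool) × (X × Bool) × (X × Bool))),
      ∃ r : Setoid X,
        (∀ x y : X, r.r x y →
          ∀ s : X → Bool,
            (∀ c ∈ C,
              ((if s c.1.1 = c.1.2 then 1 else 0) +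
               (if s c.2.1.1 = c.2.1.2 then 1 else 0) +
               (if s c.2.2.1 = c.2.2.2 then 1 else 0) : ℕ) = 1) →
            s x = s y) ∧
        (C.image (fun c =>
            ((Quotient.mk r c.1.1, c.1.2),
             (Quotient.mk r c.2.1.1, c.2.1.2),
             (Quotient.mk r c.2.2.1, c.2.2.2)))).card
          ≤ 8 * f (2 * Fintype.card X) := by
  intro X _ C
  obtain ⟨r, hr, hcard⟩ := hmono (X × Bool) C
  let Sol : (X → Bool) → Prop := fun s => ∀ c ∈ C,
    ((if s c.1.1 = c.1.2 then 1 else 0) +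
      (if s c.2.1.1 = c.2.1.2 then 1 else 0) +
      (if s c.2.2.1 = c.2.2.2 then 1 else 0) : ℕ) = 1
  let e : Setoid X :=
    { r := fun x y => ∀ s, Sol s → s x = s y
      iseqv := ⟨fun _ _ _ => rfl, fun h s hs => (h s hs).symm,
        fun h₁ h₂ s hs => (h₁ s hs).trans (h₂ s hs)⟩ }
  have key : ∀ l m : X × Bool, Quotient.mk r l = Quotient.mk r m → l.2 = m.2 →
      Quotient.mk e l.1 = Quotient.mk e m.1 := by
    rintro ⟨x, b⟩ ⟨y, b'⟩ hq rfl
    refine Quotient.sound fun s hs => ?_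
    have h := hr _ _ (Quotient.exact hq) (fun l => decide (s l.1 = l.2)) fun c hc => by
      simpa only [Bool.toNat, Bool.cond_decide] using hs c hc
    have h' : s x = b ↔ s y = b := by simpa using h
    clear h hs hq hr hcard hmono
    change s x = s y
    revert h'
    generalize s x = p, s y = p'
    revert p p' b
    decide
  refine ⟨e, fun x y hxy s hs => hxy s hs, ?_⟩
  let q : (X × Bool) × (X × Bool) × (X × Bool) → Quotient r × Quotient r × Quotient r :=
    fun c => (Quotient.mk r c.1, Quotient.mk r c.2.1, Quotient.mk r c.2.2)
  let signs : (X × Bool) × (X × Bool) × (X × Bool) → Bool × Bool × Bool :=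
    fun c => (c.1.2, c.2.1.2, c.2.2.2)
  calc _ ≤ (C.image fun c => (signs c, q c)).card := by
        refine card_image_le_card_image_of_factors C _ _ fun c _ d _ h => ?_
        obtain ⟨hs, hq⟩ := Prod.mk.inj h
        obtain ⟨s₁, hs⟩ := Prod.mk.inj hs
        obtain ⟨s₂, s₃⟩ := Prod.mk.inj hs
        obtain ⟨q₁, hq⟩ := Prod.mk.inj hq
        obtain ⟨q₂, q₃⟩ := Prod.mk.inj hq
        exact Prod.ext (Prod.ext (key _ _ q₁ s₁) s₁)
          (Prod.ext (Prod.ext (key _ _ q₂ s₂) s₂) (Prod.ext (key _ _ q₃ s₃) s₃))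
    _ ≤ ((Finset.univ : Finset (Bool × Bool × Bool)) ×ˢ C.image q).card := by
        refine Finset.card_le_card (Finset.image_subset_iff.mpr fun c hc => ?_)
        exact Finset.mem_product.mpr ⟨Finset.mem_univ _, Finset.mem_image_of_mem q hc⟩
    _ = 8 * (C.image q).card := by simp [Finset.card_product]
    _ ≤ 8 * f (2 * Fintype.card X) := by
        have h2 : Fintype.card (X × Bool) = 2 * Fintype.card X := by simp [mul_comm]
        exact Nat.mul_le_mul_left 8 (h2 ▸ hcard)
end
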